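/- Let Z : [t₀,∞) × ℝ → ℝ be a smooth solution of Z_t + Z Z_x = Z_{xx} that is odd in x (Z(t,−x) = −Z(t,x)) with Z_{xx}(t₀, x) ≥ 0 for all x ≥ 0 and Z(t,0) = 0 for all t ≥ t₀. Assume Z, Z_x, Z_{xx} are bounded on compact time intervals and Z_{xx}(t,x) → 0 as x → ∞ uniformly on compact time intervals. Then Z_{xx}(t,x) ≥ 0 for all t ≥ t₀ and x ≥ 0. -/

import Mathlib

open Set Filter Topology

/-- Second derivative test, necessary condition. -/
theorem IsLocalMin.deriv_deriv_nonneg {f : ℝ → ℝ} {a : ℝ} (h : IsLocalMin f a)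
    (hf : ContinuousAt f a) : 0 ≤ deriv (deriv f) a := by
  by_contra! hneg
  have hmax : IsLocalMax f a := isLocalMax_of_deriv_deriv_neg hneg h.deriv_eq_zero hf
  have hconst : f =ᶠ[𝓝 a] fun _ => f a := by
    filter_upwards [h, hmax] with x h₁ h₂ using le_antisymm h₂ h₁
  have : deriv (deriv f) a = 0 := by
    rw [hconst.deriv.deriv_eq]
    simp
  exact hneg.ne this

/-- If `f` attains its minimum over `[a, b]`, `a < b`, at the right endpoint, its derivative there
is nonpositive. -/
theorem HasDerivAt.nonpos_of_isMinOn_right {f : ℝ → ℝ} {f' a b : ℝ} (hf : HasDerivAt f f' b)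
    (hab : a < b) (hmin : ∀ s ∈ Icc a b, f b ≤ f s) : f' ≤ 0 := by
  have hloc : IsLocalMinOn f (Icc a b) b := by
    filter_upwards [self_mem_nhdsWithin] with s hs using hmin s hs
  have hy : a - b ∈ posTangentConeAt (Icc a b) b :=
    sub_mem_posTangentConeAt_of_segment_subset (by
      rw [segment_symm, segment_eq_Icc hab.le])
  have := hloc.hasFDerivWithinAt_nonneg hf.hasFDerivAt.hasFDerivWithinAt hy
  simp only [ContinuousLinearMap.toSpanSingleton_apply, smul_eq_mul] at this
  nlinarith

/-- Weak minimum principle on the quarter plane for `u_t + b u_x + c u = u_xx`, with `c` bounded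
below and `u` asymptotically nonnegative at spatial infinity. -/
theorem nonneg_of_parabolic_halfLine {u b c : ℝ → ℝ → ℝ} {t₀ T K : ℝ}
    (hcont : Continuous (Function.uncurry u))
    (hdiff : ∀ t x, DifferentiableAt ℝ (fun s => u s x) t)
    (hpde : ∀ t ∈ Icc t₀ T, ∀ x, 0 ≤ x →
      deriv (fun s => u s x) t + b t x * deriv (u t) x + c t x * u t x = deriv (deriv (u t)) x)
    (hc : ∀ t ∈ Icc t₀ T, ∀ x, 0 ≤ x → -K ≤ c t x)
    (hinit : ∀ x, 0 ≤ x → 0 ≤ u t₀ x)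
    (hbdry : ∀ t ∈ Icc t₀ T, 0 ≤ u t 0)
    (hdecay : ∀ ε > 0, ∃ R, ∀ t ∈ Icc t₀ T, ∀ x, R ≤ x → -ε ≤ u t x)
    {t x : ℝ} (ht : t ∈ Icc t₀ T) (hx : 0 ≤ x) : 0 ≤ u t x := by
  by_contra! hneg
  set L : ℝ := max K 0 + 1 with hL
  have hL0 : 0 < L := by positivity
  have hKL : K < L := by linarith [le_max_left K 0]
  set v : ℝ × ℝ → ℝ := fun p => Real.exp (-L * (p.1 - t₀)) * u p.1 p.2 with hv
  have hvcont : Continuous v := by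
    have : Continuous fun p : ℝ × ℝ => u p.1 p.2 := hcont
    fun_prop
  have hvneg : v (t, x) < 0 := mul_neg_of_pos_of_neg (Real.exp_pos _) hneg
  obtain ⟨R, hR⟩ := hdecay (-v (t, x) / 2) (by linarith)
  set M : ℝ := max R x with hM
  have hxM : x ≤ M := le_max_right _ _
  obtain ⟨⟨t₁, x₁⟩, ⟨ht₁, hx₁⟩, hmin⟩ :=
    (isCompact_Icc.prod isCompact_Icc : IsCompact (Icc t₀ T ×ˢ Icc 0 M)).exists_isMinOn
      ⟨(t, x), ht, hx, hxM⟩ hvcont.continuousOn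
  simp only at ht₁ hx₁
  have hle : v (t₁, x₁) ≤ v (t, x) := hmin ⟨ht, hx, hxM⟩
  have hu₁ : u t₁ x₁ < 0 := by
    by_contra! h
    have : 0 ≤ v (t₁, x₁) := mul_nonneg (Real.exp_pos _).le h
    linarith
  have htlt : t₀ < t₁ := by
    refine lt_of_le_of_ne ht₁.1 ?_
    rintro rfl
    exact (hinit x₁ hx₁.1).not_gt hu₁
  have hxpos : 0 < x₁ := by
    refine lt_of_le_of_ne hx₁.1 ?_
    rintro rfl
    exact (hbdry t₁ ht₁).not_gt hu₁
  have hxlt : x₁ < M := by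
    by_contra! h
    have hu := hR t₁ ht₁ x₁ ((le_max_left _ _).trans h)
    have he : Real.exp (-L * (t₁ - t₀)) ≤ 1 :=
      Real.exp_le_one_iff.2 (by nlinarith)
    have : u t₁ x₁ ≤ v (t₁, x₁) := by
      simp only [hv]
      nlinarith
    linarith
  have hlocmin : IsLocalMin (u t₁) x₁ := by
    filter_upwards [Ioo_mem_nhds hxpos hxlt] with y hy
    exact le_of_mul_le_mul_left (hmin (show (t₁, y) ∈ Icc t₀ T ×ˢ Icc 0 M from
      ⟨ht₁, hy.1.le, hy.2.le⟩)) (Real.exp_pos _)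
  have hux : deriv (u t₁) x₁ = 0 := hlocmin.deriv_eq_zero
  have huxx : 0 ≤ deriv (deriv (u t₁)) x₁ :=
    hlocmin.deriv_deriv_nonneg (by
      have : Continuous (u t₁) := hcont.comp (Continuous.prodMk_right t₁)
      exact this.continuousAt)
  have hexp : HasDerivAt (fun s => Real.exp (-L * (s - t₀)))
      (Real.exp (-L * (t₁ - t₀)) * (-L * 1)) t₁ :=
    (((hasDerivAt_id t₁).sub_const t₀).const_mul (-L)).exp
  have hvt := (hexp.mul (hdiff t₁ x₁).hasDerivAt).nonpos_of_isMinOn_right htlt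
    fun s hs => hmin (show (s, x₁) ∈ Icc t₀ T ×ˢ Icc 0 M from
      ⟨⟨hs.1, hs.2.trans ht₁.2⟩, hx₁⟩)
  have hut : deriv (fun s => u s x₁) t₁ - L * u t₁ x₁ ≤ 0 := by
    by_contra! h
    nlinarith [mul_pos (Real.exp_pos (-L * (t₁ - t₀))) h]
  have heq := hpde t₁ ht₁ x₁ hx₁.1
  rw [hux] at heq
  nlinarith [hc t₁ ht₁ x₁ hx₁.1]

section PartialDerivatives

variable {F : ℝ → ℝ → ℝ}

theorem hasDerivAt_snd_of_contDiff (hF : ContDiff ℝ (⊤ : ℕ∞) (Function.uncurry F)) (t x : ℝ) :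
    HasDerivAt (F t) (fderiv ℝ (Function.uncurry F) (t, x) (0, 1)) x :=
  ((hF.differentiable (by simp)) (t, x)).hasFDerivAt.comp_hasDerivAt x
    ((hasDerivAt_const x t).prodMk (hasDerivAt_id x))

theorem hasDerivAt_fst_of_contDiff (hF : ContDiff ℝ (⊤ : ℕ∞) (Function.uncurry F)) (t x : ℝ) :
    HasDerivAt (fun s => F s x) (fderiv ℝ (Function.uncurry F) (t, x) (1, 0)) t :=
  HasFDerivAt.comp_hasDerivAt (l := Function.uncurry F) t
    ((hF.differentiable (by simp)) (t, x)).hasFDerivAt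
    ((hasDerivAt_id' t).prodMk (hasDerivAt_const t x))

theorem contDiff_uncurry_deriv_snd (hF : ContDiff ℝ (⊤ : ℕ∞) (Function.uncurry F)) :
    ContDiff ℝ (⊤ : ℕ∞) (Function.uncurry fun t => deriv (F t)) := by
  have : (Function.uncurry fun t => deriv (F t)) =
      fun p => fderiv ℝ (Function.uncurry F) p (0, 1) := by
    ext ⟨t, x⟩
    exact (hasDerivAt_snd_of_contDiff hF t x).deriv
  rw [this]
  exact (hF.fderiv_right (by simp)).clm_apply contDiff_const

/-- Equality of mixed partial derivatives. -/
theorem deriv_fst_deriv_snd_comm (hF : ContDiff ℝ (⊤ : ℕ∞) (Function.uncurry F)) (t x : ℝ) :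
    deriv (fun s => deriv (F s) x) t = deriv (fun y => deriv (fun s => F s y) t) x := by
  have hsymm : IsSymmSndFDerivAt ℝ (Function.uncurry F) (t, x) :=
    hF.contDiffAt.isSymmSndFDerivAt (by
      simpa using WithTop.coe_le_coe.2 (le_top : (2 : ℕ∞) ≤ ⊤))
  have hd : HasFDerivAt (fderiv ℝ (Function.uncurry F))
      (fderiv ℝ (fderiv ℝ (Function.uncurry F)) (t, x)) (t, x) :=
    (((hF.fderiv_right (m := (⊤ : ℕ∞)) (by simp)).differentiable (by simp)) (t, x)).hasFDerivAt
  have hd_apply (v : ℝ × ℝ) :=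
    (ContinuousLinearMap.apply ℝ ℝ v).hasFDerivAt.comp (t, x) hd
  have h₁ : HasDerivAt (fun s => deriv (F s) x)
      (fderiv ℝ (fderiv ℝ (Function.uncurry F)) (t, x) (1, 0) (0, 1)) t := by
    simp only [fun s => (hasDerivAt_snd_of_contDiff hF s x).deriv]
    exact (hd_apply (0, 1)).comp_hasDerivAt t
      ((hasDerivAt_id' t).prodMk (hasDerivAt_const t x))
  have h₂ : HasDerivAt (fun y => deriv (fun s => F s y) t)
      (fderiv ℝ (fderiv ℝ (Function.uncurry F)) (t, x) (0, 1) (1, 0)) x := by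
    simp only [fun y => (hasDerivAt_fst_of_contDiff hF t y).deriv]
    exact (hd_apply (1, 0)).comp_hasDerivAt x
      ((hasDerivAt_const x t).prodMk (hasDerivAt_id' x))
  rw [h₁.deriv, h₂.deriv, hsymm.eq]

end PartialDerivatives

/-- The equation satisfied by the second space derivative of a solution of Burgers' equation. -/
theorem burgers_deriv_deriv_eq {Z : ℝ → ℝ → ℝ} {t : ℝ}
    (hZ : ContDiff ℝ (⊤ : ℕ∞) (Function.uncurry Z))
    (hpde : ∀ x, deriv (fun s => Z s x) t + Z t x * deriv (Z t) x = deriv (deriv (Z t)) x)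
    (x : ℝ) :
    deriv (fun s => deriv (deriv (Z s)) x) t + Z t x * deriv (deriv (deriv (Z t))) x
      + 3 * deriv (Z t) x * deriv (deriv (Z t)) x = deriv (deriv (deriv (deriv (Z t)))) x := by
  have hZ₁ := contDiff_uncurry_deriv_snd hZ
  have hZ₂ := contDiff_uncurry_deriv_snd hZ₁
  have hZ₃ := contDiff_uncurry_deriv_snd hZ₂
  have d₀ y := (hasDerivAt_snd_of_contDiff hZ t y).differentiableAt.hasDerivAt
  have d₁ y := (hasDerivAt_snd_of_contDiff hZ₁ t y).differentiableAt.hasDerivAt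
  have d₂ y := (hasDerivAt_snd_of_contDiff hZ₂ t y).differentiableAt.hasDerivAt
  have d₃ y := (hasDerivAt_snd_of_contDiff hZ₃ t y).differentiableAt.hasDerivAt
  have hZt : (fun y => deriv (fun s => Z s y) t) =
      fun y => deriv (deriv (Z t)) y - Z t y * deriv (Z t) y :=
    funext fun y => by linarith [hpde y]
  have hZxt : (fun y => deriv (fun s => deriv (Z s) y) t) =
      fun y => deriv (deriv (deriv (Z t))) y -
        (deriv (Z t) y * deriv (Z t) y + Z t y * deriv (deriv (Z t)) y) :=
    funext fun y => by
      rw [deriv_fst_deriv_snd_comm hZ, hZt]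
      exact ((d₂ y).sub ((d₀ y).mul (d₁ y))).deriv
  have hZxxt : deriv (fun s => deriv (deriv (Z s)) x) t =
      deriv (deriv (deriv (deriv (Z t)))) x -
        (deriv (deriv (Z t)) x * deriv (Z t) x + deriv (Z t) x * deriv (deriv (Z t)) x +
          (deriv (Z t) x * deriv (deriv (Z t)) x + Z t x * deriv (deriv (deriv (Z t))) x)) := by
    rw [deriv_fst_deriv_snd_comm hZ₁, hZxt]
    exact ((d₃ x).sub (((d₁ x).mul (d₁ x)).add ((d₀ x).mul (d₂ x)))).deriv
  rw [hZxxt]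
  ring

/-- The second derivative of an odd function vanishes at the origin. -/
theorem deriv_deriv_zero_of_odd {f : ℝ → ℝ} (hf : ∀ x, f (-x) = -f x) :
    deriv (deriv f) 0 = 0 := by
  have h₁ : ∀ x, deriv f (-x) = deriv f x := fun x => by
    have h := deriv_comp_neg f x
    simp only [hf, deriv.fun_neg] at h
    linarith
  have h₂ := deriv_comp_neg (deriv f) 0
  simp only [h₁, neg_zero] at h₂
  have h₃ : deriv (fun x => deriv f x) 0 = deriv (deriv f) 0 := rfl
  linarith

/-- Preservation of convexity on the half-line `x ≥ 0` for an odd smooth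
solution of the viscous Burgers equation `Z_t + Z Z_x = Z_xx`. -/
theorem burgers_convexity_preserved (t₀ : ℝ) (Z : ℝ → ℝ → ℝ)
    (hZ : ContDiff ℝ (⊤ : ℕ∞) (Function.uncurry Z))
    (hpde : ∀ t x : ℝ, t₀ ≤ t →
      deriv (fun s => Z s x) t + Z t x * deriv (fun y => Z t y) x
        = deriv (deriv (fun y => Z t y)) x)
    (hodd : ∀ t x : ℝ, Z t (-x) = -Z t x)
    (hinit : ∀ x : ℝ, 0 ≤ x → 0 ≤ deriv (deriv (fun y => Z t₀ y)) x)
    (hzero : ∀ t : ℝ, t₀ ≤ t → Z t 0 = 0)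
    (hbdd : ∀ T : ℝ, t₀ ≤ T → ∃ Cb : ℝ, ∀ t ∈ Set.Icc t₀ T, ∀ x : ℝ,
      |Z t x| ≤ Cb ∧ |deriv (fun y => Z t y) x| ≤ Cb ∧
        |deriv (deriv (fun y => Z t y)) x| ≤ Cb)
    (hdecay : ∀ T : ℝ, t₀ ≤ T → ∀ εp : ℝ, 0 < εp → ∃ R : ℝ,
      ∀ t ∈ Set.Icc t₀ T, ∀ x : ℝ, R ≤ x →
        |deriv (deriv (fun y => Z t y)) x| ≤ εp) :
    ∀ t x : ℝ, t₀ ≤ t → 0 ≤ x → 0 ≤ deriv (deriv (fun y => Z t y)) x := by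
  intro t x ht hx
  obtain ⟨C, hC⟩ := hbdd t ht
  have hZ₂ := contDiff_uncurry_deriv_snd (contDiff_uncurry_deriv_snd hZ)
  refine nonneg_of_parabolic_halfLine (u := fun s => deriv (deriv (Z s))) (b := Z)
    (c := fun s y => 3 * deriv (Z s) y) (t₀ := t₀) (T := t) (K := 3 * C) hZ₂.continuous
    (fun s y => (hasDerivAt_fst_of_contDiff hZ₂ s y).differentiableAt)
    (fun s hs y _ => burgers_deriv_deriv_eq hZ (fun z => hpde s z hs.1) y)
    (fun s hs y _ => ?_) hinit (fun s _ => (deriv_deriv_zero_of_odd (hodd s)).ge)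
    (fun ε hε => ?_) ⟨ht, le_rfl⟩ hx
  · have := neg_le_of_abs_le (hC s hs y).2.1
    linarith
  · obtain ⟨R, hR⟩ := hdecay t ht ε hε
    exact ⟨R, fun s hs y hy => neg_le_of_abs_le (hR s hs y hy)⟩
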